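/- arXiv:1910.03142 — 2 statements merged into one kernel-verified Lean document; each statement's English description precedes it below -/
import Mathlib

section
/- For the elephant random walk with memory parameter p ≤ 3/4, almost surely limsup_{n→∞} X_n = +∞ and liminf_{n→∞} X_n = −∞. -/
open MeasureTheory Filter

/-- The natural filtration generated by the steps `η 1, …, η n`. -/
noncomputable def erwFil {Ω : Type*} (η : ℕ → Ω → ℝ) (n : ℕ) : MeasurableSpace Ω :=
  ⨆ k ∈ Finset.Icc 1 n, MeasurableSpace.comap (η k) Real.measurableSpace

/-- The position of the elephant random walk after `n` steps. -/
noncomputable def erwX {Ω : Type*} (η : ℕ → Ω → ℝ) (n : ℕ) (ω : Ω) : ℝ :=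
  ∑ k ∈ Finset.Icc 1 n, η k ω

/-- `η` is an elephant random walk with memory parameter `p` and
first-step parameter `r` on the probability space `(Ω, μ)`. -/
structure IsERW {Ω : Type*} [MeasurableSpace Ω] (μ : Measure Ω) (p r : ℝ)
    (η : ℕ → Ω → ℝ) : Prop where
  prob : IsProbabilityMeasure μ
  p_mem : p ∈ Set.Icc (0 : ℝ) 1
  r_mem : r ∈ Set.Icc (0 : ℝ) 1
  meas : ∀ k, Measurable (η k)
  pm : ∀ k, 1 ≤ k → ∀ ω, η k ω = 1 ∨ η k ω = -1
  first : μ {ω | η 1 ω = 1} = ENNReal.ofReal r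
  cond : ∀ n, 1 ≤ n →
    μ[η (n + 1)|erwFil η n] =ᵐ[μ] fun ω => (2 * p - 1) * erwX η n ω / n

namespace ERWAux

/-- Shifted, filtration-agnostic version of the walk. -/
structure Core {Ω : Type*} {m0 : MeasurableSpace Ω} (μ : Measure Ω) (ℱ : Filtration ℕ m0)
    (a : ℝ) (S : ℕ → Ω → ℝ) : Prop where
  adp : ∀ n, StronglyMeasurable[ℱ n] (S n)
  step : ∀ n ω, S (n + 1) ω - S n ω = 1 ∨ S (n + 1) ω - S n ω = -1
  bd : ∀ n ω, |S n ω| ≤ n + 1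
  cond : ∀ n, μ[S (n + 1) - S n | ℱ n] =ᵐ[μ] fun ω => a * S n ω / (n + 1)

variable {Ω : Type*} {m0 : MeasurableSpace Ω} {μ : Measure Ω} {ℱ : Filtration ℕ m0}
  {a : ℝ} {S : ℕ → Ω → ℝ}

theorem Core.neg (h : Core μ ℱ a S) : Core μ ℱ a (fun n ω => - S n ω) where
  adp n := (h.adp n).neg
  step n ω := by rcases h.step n ω with h1 | h1 <;> [right; left] <;> linarith
  bd n ω := by simpa using h.bd n ω
  cond n := by
    have e : ((fun ω => - S (n + 1) ω) - fun ω => - S n ω) = - (S (n + 1) - S n) := by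
      ext ω; simp; ring
    rw [e]
    refine (condExp_neg _ _).trans ?_
    filter_upwards [h.cond n] with ω hω
    rw [Pi.neg_apply, hω]; ring

/-- The centred increments. -/
noncomputable def D (a : ℝ) (S : ℕ → Ω → ℝ) (n : ℕ) (ω : Ω) : ℝ :=
  S (n + 1) ω - S n ω - a * S n ω / (n + 1)

/-- Weighted sums of centred increments. -/
noncomputable def W (a : ℝ) (c : ℕ → ℝ) (S : ℕ → Ω → ℝ) (n : ℕ) (ω : Ω) : ℝ :=
  ∑ k ∈ Finset.range n, c k * D a S k ω

theorem W_succ (a : ℝ) (c : ℕ → ℝ) (S : ℕ → Ω → ℝ) (n : ℕ) (ω : Ω) :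
    W a c S (n + 1) ω = W a c S n ω + c n * D a S n ω := by
  simp [W, Finset.sum_range_succ]

theorem integrable_of_bdd [IsFiniteMeasure μ] {n : ℕ} {f : Ω → ℝ}
    (hf : StronglyMeasurable[ℱ n] f) (C : ℝ) (hC : ∀ ω, |f ω| ≤ C) : Integrable f μ :=
  Integrable.of_bound (hf.mono (ℱ.le n)).aestronglyMeasurable C (Eventually.of_forall hC)

theorem Core.drift_le (h : Core μ ℱ a S) (n : ℕ) (ω : Ω) : |a * S n ω / (n + 1)| ≤ |a| := by
  have hn : (0 : ℝ) < n + 1 := by positivity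
  rw [abs_div, abs_mul, abs_of_pos hn, div_le_iff₀ hn]
  exact mul_le_mul_of_nonneg_left (h.bd n ω) (abs_nonneg a)

theorem Core.sm_drift (h : Core μ ℱ a S) (n : ℕ) :
    StronglyMeasurable[ℱ n] (fun ω => a * S n ω / (n + 1)) := by
  have := (h.adp n).const_mul (a / (n + 1))
  have e : (fun ω => a * S n ω / ((n : ℝ) + 1)) = fun ω => a / (n + 1) * S n ω := by
    ext ω; ring
  rw [e]; exact this

theorem Core.step_abs (h : Core μ ℱ a S) (n : ℕ) (ω : Ω) : |S (n + 1) ω - S n ω| ≤ 1 := by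
  rcases h.step n ω with h1 | h1 <;> rw [h1] <;> simp

theorem Core.sm_D (h : Core μ ℱ a S) (n : ℕ) : StronglyMeasurable[ℱ (n + 1)] (D a S n) :=
  ((h.adp (n + 1)).sub ((h.adp n).mono (ℱ.mono n.le_succ))).sub
    ((h.sm_drift n).mono (ℱ.mono n.le_succ))

theorem Core.D_le (h : Core μ ℱ a S) (ha : |a| ≤ 1) (n : ℕ) (ω : Ω) : |D a S n ω| ≤ 2 := by
  have h1 := abs_sub (S (n + 1) ω - S n ω) (a * S n ω / (n + 1))
  have := h.step_abs n ω
  have := h.drift_le n ω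
  unfold D
  linarith

theorem Core.condExp_D [IsProbabilityMeasure μ] (h : Core μ ℱ a S) (n : ℕ) :
    μ[D a S n | ℱ n] =ᵐ[μ] 0 := by
  have e : D a S n = (S (n + 1) - S n) - fun ω => a * S n ω / (n + 1) := by
    ext ω; simp [D]
  have i1 : Integrable (S (n + 1) - S n) μ :=
    integrable_of_bdd ((h.adp (n + 1)).sub ((h.adp n).mono (ℱ.mono n.le_succ))) 1 (h.step_abs n)
  have i2 : Integrable (fun ω => a * S n ω / (n + 1)) μ :=
    integrable_of_bdd (h.sm_drift n) _ (h.drift_le n)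
  rw [e]
  refine (condExp_sub i1 i2 _).trans ?_
  rw [condExp_of_stronglyMeasurable (ℱ.le n) (h.sm_drift n) i2]
  filter_upwards [h.cond n] with ω hω
  simp [hω]

theorem Core.integral_mul_D [IsProbabilityMeasure μ] (h : Core μ ℱ a S) (ha : |a| ≤ 1) (n : ℕ)
    {Z : Ω → ℝ} (hZ : StronglyMeasurable[ℱ n] Z) (C : ℝ) (hC : ∀ ω, |Z ω| ≤ C) :
    ∫ ω, Z ω * D a S n ω ∂μ = 0 := by
  have hm := condExp_stronglyMeasurable_mul_of_bound (ℱ.le n) hZ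
    (integrable_of_bdd (μ := μ) (h.sm_D n) 2 (h.D_le ha n)) C (Eventually.of_forall hC)
  have : ∫ ω, (Z * D a S n) ω ∂μ = 0 := by
    rw [← integral_condExp (ℱ.le n)]
    refine integral_eq_zero_of_ae ?_
    filter_upwards [hm, h.condExp_D n] with ω h1 h2
    rw [h1]; simp [h2]
  simpa using this

theorem Core.sm_W (h : Core μ ℱ a S) (c : ℕ → ℝ) (n : ℕ) :
    StronglyMeasurable[ℱ n] (W a c S n) := by
  induction n with
  | zero =>
    have : W a c S 0 = fun _ => 0 := by ext; simp [W]
    rw [this]; exact stronglyMeasurable_const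
  | succ n ih =>
    have : W a c S (n + 1) = fun ω => W a c S n ω + c n * D a S n ω := by
      ext ω; exact W_succ ..
    rw [this]
    exact (ih.mono (ℱ.mono n.le_succ)).add ((h.sm_D n).const_mul _)

theorem Core.W_inc (h : Core μ ℱ a S) (ha : |a| ≤ 1) {c : ℕ → ℝ} (hc : ∀ k, |c k| ≤ 1) (n : ℕ)
    (ω : Ω) : |W a c S (n + 1) ω - W a c S n ω| ≤ 2 := by
  rw [W_succ, add_sub_cancel_left, abs_mul]
  have := h.D_le ha n ω
  have := hc n
  nlinarith [abs_nonneg (c n), abs_nonneg (D a S n ω)]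

theorem Core.W_le (h : Core μ ℱ a S) (ha : |a| ≤ 1) {c : ℕ → ℝ} (hc : ∀ k, |c k| ≤ 1) (n : ℕ)
    (ω : Ω) : |W a c S n ω| ≤ 2 * n := by
  induction n with
  | zero => simp [W]
  | succ n ih =>
    have := h.W_inc ha hc n ω
    have h2 := abs_add_le (W a c S (n + 1) ω - W a c S n ω) (W a c S n ω)
    rw [sub_add_cancel] at h2
    push_cast
    linarith

theorem Core.mart [IsProbabilityMeasure μ] (h : Core μ ℱ a S) (ha : |a| ≤ 1) {c : ℕ → ℝ}
    (hc : ∀ k, |c k| ≤ 1) : Martingale (W a c S) ℱ μ := by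
  refine martingale_of_condExp_sub_eq_zero_nat (h.sm_W c)
    (fun n => integrable_of_bdd (h.sm_W c n) _ (h.W_le ha hc n)) fun n => ?_
  have : W a c S (n + 1) - W a c S n = c n • D a S n := by
    ext ω; simp [W_succ]
  rw [this]
  refine (condExp_smul _ _ _).trans ?_
  filter_upwards [h.condExp_D n] with ω hω
  simp [hω]

/-- For `a ≤ 0`, the walk is nonnegative infinitely often. -/
theorem Core.freq_nonneg [IsProbabilityMeasure μ] (h : Core μ ℱ a S) (ha : |a| ≤ 1)
    (ha0 : a ≤ 0) : ∀ᵐ ω ∂μ, ∃ᶠ n in atTop, 0 ≤ S n ω := by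
  have hc : ∀ k : ℕ, |(fun _ => (1 : ℝ)) k| ≤ 1 := by simp
  have hM := h.mart ha hc
  filter_upwards [hM.submartingale.bddAbove_iff_exists_tendsto (R := 2)
    (Eventually.of_forall fun ω n => h.W_inc ha hc n ω)] with ω hω
  intro hneg
  simp only [not_le] at hneg
  obtain ⟨m, hm⟩ := eventually_atTop.1 hneg
  have hdr : ∀ n, m ≤ n → 0 ≤ a * S n ω / (n + 1) := fun n hn =>
    div_nonneg (mul_nonneg_of_nonpos_of_nonpos ha0 (hm n hn).le) (by positivity)
  have hb : ∀ n, m ≤ n → W a (fun _ => 1) S n ω ≤ W a (fun _ => 1) S m ω + S n ω - S m ω := by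
    intro n hn
    induction n, hn using Nat.le_induction with
    | base => simp
    | succ n hn ih =>
      rw [W_succ]
      have := hdr n hn
      unfold D
      linarith
  have hbd : BddAbove (Set.range fun n => W a (fun _ => 1) S n ω) := by
    refine IsBoundedUnder.bddAbove_range (isBoundedUnder_of_eventually_le
      (a := W a (fun _ => 1) S m ω - S m ω) ?_)
    filter_upwards [eventually_ge_atTop m] with n hn
    linarith [hb n hn, hm n hn]
  obtain ⟨l, hl⟩ := hω.1 hbd
  have hinc : Tendsto (fun n => D a S n ω) atTop (nhds 0) := by
    have := ((tendsto_add_atTop_iff_nat 1).2 hl).sub hl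
    simpa [W_succ] using this
  obtain ⟨m', hm'⟩ := eventually_atTop.1 (hinc.eventually (lt_mem_nhds (show (-1 : ℝ) < 0 by norm_num)))
  set M := max m m'
  have hup : ∀ k : ℕ, S (M + k) ω = S M ω + k := by
    intro k
    induction k with
    | zero => simp
    | succ k ih =>
      have h1 := hm' (M + k) (by omega)
      have h2 := hdr (M + k) (by omega)
      unfold D at h1
      rcases h.step (M + k) ω with h3 | h3
      · rw [← add_assoc]; push_cast; linarith
      · linarith
  obtain ⟨k, hk⟩ := exists_nat_gt (- S M ω)
  have := hm (M + k) (by omega)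
  linarith [hup k]

/-- Climbing by one unit. -/
theorem Core.climb [IsProbabilityMeasure μ] (h : Core μ ℱ a S) (ha : |a| ≤ 1) (j : ℝ) :
    ∀ᵐ ω ∂μ, (∃ᶠ n in atTop, j ≤ S n ω) → ∃ᶠ n in atTop, j + 1 ≤ S n ω := by
  classical
  set T : ℕ → Set Ω := fun n => S n ⁻¹' Set.Ico j (j + 1) with hT
  have hTm : ∀ n, MeasurableSet[ℱ n] (T n) := fun n =>
    (h.adp n).measurable measurableSet_Ico
  set s : ℕ → Set Ω := fun n => Nat.casesOn n ∅
    (fun n => T n ∩ (S (n + 1) - S n) ⁻¹' {1}) with hs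
  have hdm : ∀ n, StronglyMeasurable[ℱ (n + 1)] (S (n + 1) - S n) := fun n =>
    (h.adp (n + 1)).sub ((h.adp n).mono (ℱ.mono n.le_succ))
  have hsm : ∀ n, MeasurableSet[ℱ n] (s n) := by
    intro n
    cases n with
    | zero => exact @MeasurableSet.empty Ω (ℱ 0)
    | succ n =>
      exact (ℱ.mono n.le_succ _ (hTm n)).inter ((hdm n).measurable (measurableSet_singleton 1))
  have hcond : ∀ᵐ ω ∂μ, ∀ n, (μ[(s (n + 1)).indicator (1 : Ω → ℝ) | ℱ n]) ω
      = (T n).indicator 1 ω * ((1 + a * S n ω / (n + 1)) / 2) := by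
    rw [ae_all_iff]
    intro n
    have hTi : StronglyMeasurable[ℱ n] ((T n).indicator (1 : Ω → ℝ)) :=
      stronglyMeasurable_one.indicator (hTm n)
    have e : (s (n + 1)).indicator (1 : Ω → ℝ)
        = (T n).indicator 1 * ((1 / 2 : ℝ) • ((fun _ => (1 : ℝ)) + (S (n + 1) - S n))) := by
      ext ω
      by_cases h1 : ω ∈ T n
      · rcases h.step n ω with h2 | h2
        · have : ω ∈ s (n + 1) := ⟨h1, by simpa using h2⟩
          simp [h1, this, h2]; norm_num
        · have : ω ∉ s (n + 1) := by
            rintro ⟨_, h3⟩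
            have : S (n + 1) ω - S n ω = 1 := h3
            linarith
          simp [h1, this, h2]
      · have : ω ∉ s (n + 1) := fun h3 => h1 h3.1
        simp [h1, this]
    have i1 : Integrable (S (n + 1) - S n) μ := integrable_of_bdd (hdm n) 1 (h.step_abs n)
    have i2 : Integrable (fun _ : Ω => (1 : ℝ)) μ := integrable_const _
    have k1 := condExp_stronglyMeasurable_mul_of_bound (ℱ.le n) hTi
      ((i2.add i1).smul (1 / 2 : ℝ)) 1 (Eventually.of_forall fun ω => by
        by_cases h1 : ω ∈ T n <;> simp [h1])
    rw [e]
    filter_upwards [k1, condExp_smul (μ := μ) (1 / 2 : ℝ) ((fun _ => (1 : ℝ)) + (S (n + 1) - S n)) (ℱ n),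
      condExp_add i2 i1 (ℱ n), h.cond n] with ω q1 q2 q3 q4
    rw [q1, Pi.mul_apply, q2, Pi.smul_apply, q3, Pi.add_apply, q4,
      condExp_const (ℱ.le n)]
    simp only [smul_eq_mul]
    ring
  filter_upwards [ae_mem_limsup_atTop_iff μ hsm, hcond] with ω h1 h2 hj
  intro hlt
  simp only [not_le] at hlt
  have hfT : ∃ᶠ n in atTop, ω ∈ T n := by
    refine (hj.and_eventually hlt).mono fun n hn => ?_
    exact ⟨hn.1, hn.2⟩
  have hdiv : Tendsto (fun n => ∑ k ∈ Finset.range n, (T k).indicator (1 : Ω → ℝ) ω) atTop atTop := by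
    have := Set.limsup_eq_tendsto_sum_indicator_atTop (zero_lt_one (α := ℝ)) T
    have h3 : ω ∈ limsup T atTop := by rwa [mem_limsup_iff_frequently_mem]
    rw [this] at h3
    exact h3
  obtain ⟨N, hN⟩ := exists_nat_gt (2 * (|j| + 1))
  have hterm : ∀ k, N ≤ k → (T k).indicator (1 : Ω → ℝ) ω * (1 / 4)
      ≤ (T k).indicator 1 ω * ((1 + a * S k ω / (k + 1)) / 2) := by
    intro k hk
    by_cases hT' : ω ∈ T k
    · have hk' : (N : ℝ) ≤ k := by exact_mod_cast hk
      have hS : |S k ω| ≤ |j| + 1 := by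
        have := hT'.1
        have := hT'.2
        rw [abs_le]
        constructor <;> cases abs_cases j <;> linarith
      have : |a * S k ω / (k + 1)| ≤ 1 / 2 := by
        have hp : (0 : ℝ) < k + 1 := by positivity
        rw [abs_div, abs_mul, abs_of_pos hp, div_le_iff₀ hp]
        nlinarith [abs_nonneg (S k ω), abs_nonneg a]
      simp only [hT', Set.indicator_of_mem, Pi.one_apply, one_mul]
      linarith [(abs_le.1 this).1]
    · simp [hT']
  have hdiv2 : Tendsto (fun n => ∑ k ∈ Finset.range n,
      (μ[(s (k + 1)).indicator (1 : Ω → ℝ) | ℱ k]) ω) atTop atTop := by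
    set u : ℕ → ℝ := fun n => ∑ k ∈ Finset.range n, (T k).indicator (1 : Ω → ℝ) ω with hu
    set v : ℕ → ℝ := fun n => ∑ k ∈ Finset.range n,
      (μ[(s (k + 1)).indicator (1 : Ω → ℝ) | ℱ k]) ω with hv
    have hge : ∀ n, N ≤ n → (v N - u N * (1 / 4)) + u n * (1 / 4) ≤ v n := by
      intro n hn
      induction n, hn using Nat.le_induction with
      | base => linarith
      | succ n hn ih =>
        have e1 : u (n + 1) = u n + (T n).indicator (1 : Ω → ℝ) ω := Finset.sum_range_succ _ _
        have e2 : v (n + 1) = v n + (μ[(s (n + 1)).indicator (1 : Ω → ℝ) | ℱ n]) ω :=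
          Finset.sum_range_succ _ _
        rw [e1, e2, h2 n]
        linarith [hterm n hn]
    refine tendsto_atTop_mono' _ ?_ (tendsto_atTop_add_const_left _ (v N - u N * (1 / 4))
      (hdiv.atTop_mul_const (show (0 : ℝ) < 1 / 4 by norm_num)))
    filter_upwards [eventually_ge_atTop N] with n hn using hge n hn
  have hfs := (mem_limsup_iff_frequently_mem).1 (h1.2 hdiv2)
  obtain ⟨n, hn1, hn2⟩ := (hfs.and_eventually hlt).exists
  cases n with
  | zero => exact hn1
  | succ n =>
    have a1 : j ≤ S n ω := hn1.1.1
    have a2 : S (n + 1) ω - S n ω = 1 := hn1.2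
    linarith

theorem Core.main_nonpos [IsProbabilityMeasure μ] (h : Core μ ℱ a S) (ha : |a| ≤ 1)
    (ha0 : a ≤ 0) : ∀ᵐ ω ∂μ, ∀ L : ℕ, ∃ᶠ n in atTop, (L : ℝ) ≤ S n ω := by
  have hcl : ∀ᵐ ω ∂μ, ∀ L : ℕ, (∃ᶠ n in atTop, (L : ℝ) ≤ S n ω) →
      ∃ᶠ n in atTop, (L : ℝ) + 1 ≤ S n ω := by
    rw [ae_all_iff]; exact fun L => h.climb ha L
  filter_upwards [hcl, h.freq_nonneg ha ha0] with ω h1 h2 L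
  induction L with
  | zero => simpa using h2
  | succ L ih => simpa using h1 L ih

/-- The weights making `b n * S n` a martingale. -/
noncomputable def b (a : ℝ) : ℕ → ℝ
  | 0 => 1
  | n + 1 => b a n * ((n + 1) / (n + 1 + a))

theorem b_pos (ha : 0 ≤ a) (n : ℕ) : 0 < b a n := by
  induction n with
  | zero => simp [b]
  | succ n ih => rw [b]; positivity

theorem b_le (ha : 0 ≤ a) (n : ℕ) : b a n ≤ 1 := by
  induction n with
  | zero => simp [b]
  | succ n ih =>
    rw [b]
    refine mul_le_one₀ ih (by positivity) ?_
    rw [div_le_one (by positivity)]; linarith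

theorem b_sq (ha : 0 ≤ a) (ha2 : a ≤ 1 / 2) (n : ℕ) : 3 / 4 ≤ b a n ^ 2 * (n + 3 / 4) := by
  induction n with
  | zero => simp [b]
  | succ n ih =>
    rw [b]
    refine ih.trans ?_
    have hn : (0 : ℝ) ≤ n := by positivity
    have key : (n : ℝ) + 3 / 4 ≤ ((n + 1) / (n + 1 + a)) ^ 2 * (n + 1 + 3 / 4) := by
      rw [div_pow, div_mul_eq_mul_div, le_div_iff₀ (by positivity)]
      have : ((n : ℝ) + 1 + a) ^ 2 ≤ (n + 3 / 2) ^ 2 := by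
        apply pow_le_pow_left₀ (by positivity); linarith
      nlinarith
    push_cast
    rw [mul_pow, mul_assoc]
    exact mul_le_mul_of_nonneg_left key (by positivity)

theorem Core.b_eq (h : Core μ ℱ a S) (ha : 0 ≤ a) (n : ℕ) (ω : Ω) :
    b a n * S n ω = S 0 ω + W a (fun k => b a (k + 1)) S n ω := by
  induction n with
  | zero => simp [b, W]
  | succ n ih =>
    rw [W_succ, ← add_assoc, ← ih]
    have : b a n = b a (n + 1) * (1 + a / (n + 1)) := by
      rw [b]; have : (n : ℝ) + 1 + a ≠ 0 := by positivity
      field_simp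
    rw [this]
    unfold D
    ring

/-- For `0 ≤ a ≤ 1/2`, the martingale is a.s. unbounded. -/
theorem Core.unbdd [IsProbabilityMeasure μ] (h : Core μ ℱ a S) (ha : 0 ≤ a) (ha2 : a ≤ 1 / 2)
    (K : ℕ) : ∀ᵐ ω ∂μ, ∃ n, (K : ℝ) < |W a (fun k => b a (k + 1)) S n ω| := by
  have ha1 : |a| ≤ 1 := by rw [abs_of_nonneg ha]; linarith
  set c : ℕ → ℝ := fun k => b a (k + 1) with hcdef
  have hc : ∀ k, |c k| ≤ 1 := fun k => by
    rw [abs_of_pos (b_pos ha _)]; exact b_le ha _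
  set V := W a c S with hV
  set A : ℕ → Set Ω := fun n => {ω | ∀ k ∈ Finset.range (n + 1), |V k ω| ≤ K} with hA
  have hAm : ∀ n, MeasurableSet[ℱ n] (A n) := by
    intro n
    have : A n = ⋂ k ∈ Finset.range (n + 1), (V k) ⁻¹' {x | |x| ≤ K} := by
      ext ω; simp [hA]
    rw [this]
    refine Finset.measurableSet_biInter _ fun k hk => ?_
    refine ℱ.mono (Nat.lt_succ_iff.1 (Finset.mem_range.1 hk)) _ ?_
    exact (h.sm_W c k).measurable (measurableSet_le measurable_norm measurable_const)
  set I : Set Ω := {ω | ∀ n, |V n ω| ≤ K} with hI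
  have hIm : MeasurableSet I := by
    have : I = ⋂ n, A n := by
      ext ω
      simp only [hI, hA, Set.mem_ofPred_eq, Set.mem_iInter, Finset.mem_range]
      exact ⟨fun h n k _ => h k, fun h n => h n n (by omega)⟩
    rw [this]
    exact MeasurableSet.iInter fun n => ℱ.le n _ (hAm n)
  set B : ℝ := ((K : ℝ) + 2) ^ 2 with hB
  set G : ℕ → Ω → ℝ := fun n => (A n).indicator (fun ω => V n ω ^ 2 - B) with hG
  set Z : ℕ → Ω → ℝ := fun n => (A n).indicator
    (fun ω => 2 * c n * V n ω - 2 * c n ^ 2 * (a * S n ω / (n + 1))) with hZ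
  have hVK : ∀ n ω, ω ∈ A n → |V n ω| ≤ K := fun n ω hω => hω n (by simp)
  have hK0 : (0 : ℝ) ≤ K := by positivity
  have hVs : ∀ n ω, ω ∈ A n → V n ω ^ 2 ≤ B := fun n ω hω => by
    rw [hB, sq_le_sq, abs_of_nonneg (by positivity : (0 : ℝ) ≤ K + 2)]
    linarith [hVK n ω hω]
  have hGs : ∀ n, StronglyMeasurable[ℱ n] (G n) := fun n =>
    (((h.sm_W c n).pow 2).sub stronglyMeasurable_const).indicator (hAm n)
  have hZs : ∀ n, StronglyMeasurable[ℱ n] (Z n) := fun n =>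
    (((h.sm_W c n).const_mul _).sub ((h.sm_drift n).const_mul _)).indicator (hAm n)
  have hGb : ∀ n ω, |G n ω| ≤ B := by
    intro n ω
    by_cases hω : ω ∈ A n
    · simp only [hG, hω, Set.indicator_of_mem]
      rw [abs_le]; constructor <;> nlinarith [hVs n ω hω, sq_nonneg (V n ω)]
    · simp only [hG, hω, not_false_eq_true, Set.indicator_of_notMem, abs_zero]; positivity
  have hZb : ∀ n ω, |Z n ω| ≤ 2 * K + 2 := by
    intro n ω
    by_cases hω : ω ∈ A n
    · simp only [hZ, hω, Set.indicator_of_mem]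
      refine (abs_sub _ _).trans ?_
      have h1 := hVK n ω hω
      have h2 := (h.drift_le n ω).trans ha1
      have h3 := hc n
      have h4 := abs_nonneg (c n)
      have h5 : |2 * c n * V n ω| ≤ 2 * K := by
        rw [abs_mul, abs_mul, abs_two]
        nlinarith [abs_nonneg (V n ω)]
      have h6 : |2 * c n ^ 2 * (a * S n ω / (n + 1))| ≤ 2 := by
        rw [abs_mul, abs_mul, abs_two, abs_pow]
        have : |c n| ^ 2 ≤ 1 := pow_le_one₀ h4 h3
        nlinarith [abs_nonneg (a * S n ω / (n + 1)), sq_nonneg (|c n|)]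
      linarith
    · simp only [hZ, hω, not_false_eq_true, Set.indicator_of_notMem, abs_zero]; positivity
  have hpt : ∀ n ω, G n ω + I.indicator (fun _ => 3 / 4 * c n ^ 2) ω + Z n ω * D a S n ω
      ≤ G (n + 1) ω := by
    intro n ω
    by_cases hω : ω ∈ A n
    · have hle : V (n + 1) ω ^ 2 - B ≤ G (n + 1) ω := by
        by_cases hω' : ω ∈ A (n + 1)
        · simp [hG, hω']
        · simp only [hG, hω', not_false_eq_true, Set.indicator_of_notMem]
          have h1 := h.W_inc ha1 hc n ω
          have h2 := abs_add_le (V (n + 1) ω - V n ω) (V n ω)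
          rw [sub_add_cancel] at h2
          have h3 := hVK n ω hω
          rw [sub_nonpos, hB, sq_le_sq, abs_of_nonneg (by positivity : (0 : ℝ) ≤ K + 2)]
          linarith
      have hind : I.indicator (fun _ => 3 / 4 * c n ^ 2) ω ≤ 3 / 4 * c n ^ 2 :=
        Set.indicator_le_self' (fun _ _ => by positivity) ω
      have hG' : G n ω = V n ω ^ 2 - B := by simp [hG, hω]
      have hZ' : Z n ω = 2 * c n * V n ω - 2 * c n ^ 2 * (a * S n ω / (n + 1)) := by
        simp [hZ, hω]
      have he : (a * S n ω / (n + 1)) ^ 2 ≤ 1 / 4 := by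
        have := h.drift_le n ω
        rw [abs_of_nonneg ha] at this
        have h2 := abs_le.1 (this.trans ha2)
        nlinarith
      have hx : (S (n + 1) ω - S n ω) ^ 2 = 1 := by
        rcases h.step n ω with h1 | h1 <;> rw [h1] <;> norm_num
      have hVV : V (n + 1) ω = V n ω + c n * D a S n ω := W_succ ..
      have hid : V (n + 1) ω ^ 2 = V n ω ^ 2 + c n ^ 2 * (1 - (a * S n ω / (n + 1)) ^ 2)
          + Z n ω * D a S n ω := by
        rw [hVV, hZ']
        unfold D
        generalize a * S n ω / ((n : ℝ) + 1) = e
        generalize S (n + 1) ω - S n ω = x at hx ⊢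
        linear_combination (c n ^ 2) * hx
      have : c n ^ 2 * (3 / 4) ≤ c n ^ 2 * (1 - (a * S n ω / (n + 1)) ^ 2) :=
        mul_le_mul_of_nonneg_left (by linarith) (sq_nonneg _)
      linarith
    · have hω' : ω ∉ A (n + 1) := fun h' => hω fun k hk =>
        h' k (Finset.mem_range.2 ((Finset.mem_range.1 hk).trans (Nat.lt_succ_self _)))
      have hω2 : ω ∉ I := fun h' => hω fun k _ => h' k
      simp [hG, hZ, hω, hω', hω2]
  have hGi : ∀ n, Integrable (G n) μ := fun n => integrable_of_bdd (hGs n) B (hGb n)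
  have hIi : ∀ n, Integrable (I.indicator (fun _ => 3 / 4 * c n ^ 2)) μ := fun n =>
    (integrable_const _).indicator hIm
  have hZDi : ∀ n, Integrable (fun ω => Z n ω * D a S n ω) μ := fun n => by
    refine integrable_of_bdd (ℱ := ℱ) (n := n + 1)
      (((hZs n).mono (ℱ.mono n.le_succ)).mul (h.sm_D n)) ((2 * K + 2) * 2) fun ω => ?_
    rw [abs_mul]
    exact mul_le_mul (hZb n ω) (h.D_le ha1 n ω) (abs_nonneg _) (by positivity)
  have hint : ∀ n, ∫ ω, G n ω ∂μ + μ.real I * (3 / 4 * c n ^ 2) ≤ ∫ ω, G (n + 1) ω ∂μ := by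
    intro n
    have := integral_mono (((hGi n).add (hIi n)).add (hZDi n)) (hGi (n + 1)) (hpt n)
    rw [integral_add' ((hGi n).add (hIi n)) (hZDi n), h.integral_mul_D ha1 n (hZs n) _ (hZb n),
      integral_add' (hGi n) (hIi n), integral_indicator_const _ hIm] at this
    simpa using this
  have hsum : ∀ n, ∫ ω, G 0 ω ∂μ + μ.real I * ∑ k ∈ Finset.range n, (3 / 4 * c k ^ 2)
      ≤ ∫ ω, G n ω ∂μ := by
    intro n
    induction n with
    | zero => simp
    | succ n ih =>
      rw [Finset.sum_range_succ, mul_add]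
      linarith [hint n]
  have hGub : ∀ n, ∫ ω, G n ω ∂μ ≤ B := fun n => by
    have := integral_mono (hGi n) (integrable_const B) fun ω => (abs_le.1 (hGb n ω)).2
    simpa using this
  have hdiv : Tendsto (fun n => ∑ k ∈ Finset.range n, (3 / 4 * c k ^ 2)) atTop atTop := by
    have h1 := Real.tendsto_sum_range_one_div_nat_succ_atTop.atTop_mul_const
      (show (0 : ℝ) < 9 / 32 by norm_num)
    refine tendsto_atTop_mono (fun n => ?_) h1
    rw [Finset.sum_mul]
    refine Finset.sum_le_sum fun k _ => ?_
    have h2 := b_sq ha ha2 (k + 1)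
    have h3 : (3 / 8 : ℝ) ≤ c k ^ 2 * (k + 1) := by
      push_cast at h2
      have : c k ^ 2 * ((k : ℝ) + 1 + 3 / 4) ≤ c k ^ 2 * (2 * (k + 1)) :=
        mul_le_mul_of_nonneg_left (by linarith [(Nat.cast_nonneg k : (0 : ℝ) ≤ k)]) (sq_nonneg _)
      have h2' : 3 / 4 ≤ c k ^ 2 * ((k : ℝ) + 1 + 3 / 4) := h2
      linarith
    have hk : (0 : ℝ) < k + 1 := by positivity
    rw [div_mul_eq_mul_div, div_le_iff₀ hk]
    linarith
  have hzero : μ.real I = 0 := by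
    by_contra hne
    have hpos : 0 < μ.real I := lt_of_le_of_ne measureReal_nonneg (Ne.symm hne)
    have h1 := hdiv.const_mul_atTop hpos
    obtain ⟨n, hn⟩ := (h1.eventually_gt_atTop (B - ∫ ω, G 0 ω ∂μ)).exists
    linarith [hsum n, hGub n]
  have hz : μ I = 0 := by rwa [measureReal_eq_zero_iff] at hzero
  have := measure_eq_zero_iff_ae_notMem.1 hz
  filter_upwards [this] with ω hω
  by_contra hcon
  push Not at hcon
  exact hω hcon

theorem Core.main_nonneg [IsProbabilityMeasure μ] (h : Core μ ℱ a S) (ha : 0 ≤ a)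
    (ha2 : a ≤ 1 / 2) : ∀ᵐ ω ∂μ, ∀ L : ℕ, ∃ᶠ n in atTop, (L : ℝ) ≤ S n ω := by
  have ha1 : |a| ≤ 1 := by rw [abs_of_nonneg ha]; linarith
  have hc : ∀ k : ℕ, |(fun k => b a (k + 1)) k| ≤ 1 := fun k => by
    simp only
    rw [abs_of_pos (b_pos ha _)]; exact b_le ha _
  have hM := h.mart ha1 hc
  filter_upwards [hM.bddAbove_range_iff_bddBelow_range (R := 2)
    (Eventually.of_forall fun ω n => h.W_inc ha1 hc n ω),
    ae_all_iff.2 (h.unbdd ha ha2)] with ω h1 h2 L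
  have hnb : ¬ BddAbove (Set.range fun n => W a (fun k => b a (k + 1)) S n ω) := by
    intro hb
    obtain ⟨u, hu⟩ := hb
    obtain ⟨l, hl⟩ := h1.1 ⟨u, hu⟩
    obtain ⟨K, hK⟩ := exists_nat_gt (max u (-l))
    obtain ⟨n, hn⟩ := h2 K
    have q1 := hu ⟨n, rfl⟩
    have q2 := hl ⟨n, rfl⟩
    have q3 := (le_max_left _ _).trans_lt hK
    have q4 := (le_max_right _ _).trans_lt hK
    simp only at q1 q2
    refine absurd hn (not_lt.2 (abs_le.2 ⟨?_, ?_⟩)) <;> linarith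
  intro hev
  apply hnb
  refine IsBoundedUnder.bddAbove_range (isBoundedUnder_of_eventually_le (a := L - S 0 ω) ?_)
  filter_upwards [hev] with n hn
  have e := h.b_eq ha n ω
  have p1 := b_pos ha n
  have p2 := b_le ha n
  have hL : (0 : ℝ) ≤ L := by positivity
  have : b a n * S n ω ≤ L := by
    rw [not_le] at hn
    nlinarith
  linarith

theorem Core.main [IsProbabilityMeasure μ] (h : Core μ ℱ a S) (ha : -1 ≤ a)
    (ha2 : a ≤ 1 / 2) : ∀ᵐ ω ∂μ, ∀ L : ℕ, ∃ᶠ n in atTop, (L : ℝ) ≤ S n ω := by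
  rcases le_total a 0 with h0 | h0
  · exact h.main_nonpos (abs_le.2 ⟨ha, by linarith⟩) h0
  · exact h.main_nonneg h0 ha2

theorem limsup_top {u : ℕ → ℝ} (hu : ∀ L : ℕ, ∃ᶠ n in atTop, (L : ℝ) ≤ u (n + 1)) :
    limsup (fun n => ((u n : ℝ) : EReal)) atTop = ⊤ := by
  rw [EReal.eq_top_iff_forall_lt]
  intro y
  obtain ⟨L, hL⟩ := exists_nat_gt y
  refine lt_of_lt_of_le (EReal.coe_lt_coe_iff.2 hL) (le_limsup_of_frequently_le' ?_)
  have := (tendsto_add_atTop_nat 1).frequently (p := fun n => (L : ℝ) ≤ u n) (hu L)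
  exact this.mono fun n hn => EReal.coe_le_coe_iff.2 hn

theorem liminf_bot {u : ℕ → ℝ} (hu : ∀ L : ℕ, ∃ᶠ n in atTop, (L : ℝ) ≤ - u (n + 1)) :
    liminf (fun n => ((u n : ℝ) : EReal)) atTop = ⊥ := by
  rw [EReal.eq_bot_iff_forall_lt]
  intro y
  obtain ⟨L, hL⟩ := exists_nat_gt (-y)
  refine lt_of_le_of_lt (liminf_le_of_frequently_le' (x := ((-L : ℝ) : EReal)) ?_)
    (EReal.coe_lt_coe_iff.2 (by linarith))
  have := (tendsto_add_atTop_nat 1).frequently (p := fun n => (L : ℝ) ≤ - u n) (hu L)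
  exact this.mono fun n hn => EReal.coe_le_coe_iff.2 (by linarith)

theorem erwFil_mono (η : ℕ → Ω → ℝ) : Monotone (erwFil η) := by
  intro m n hmn
  unfold erwFil
  refine iSup₂_le fun k hk => ?_
  exact le_iSup₂_of_le k (Finset.Icc_subset_Icc_right hmn hk) le_rfl

theorem core_of_erw {p r : ℝ} {η : ℕ → Ω → ℝ} (h : IsERW μ p r η) :
    ∃ ℱ : Filtration ℕ m0, Core μ ℱ (2 * p - 1) (fun n => erwX η (n + 1)) := by
  refine ⟨⟨fun n => erwFil η (n + 1), fun m n hmn => erwFil_mono η (by omega), fun n =>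
    iSup₂_le fun k _ => (h.meas k).comap_le⟩, ?_⟩
  have hsucc : ∀ n ω, erwX η (n + 1) ω = erwX η n ω + η (n + 1) ω := fun n ω =>
    Finset.sum_Icc_succ_top (by omega) _
  have hstep : ∀ n ω, erwX η (n + 1 + 1) ω - erwX η (n + 1) ω = η (n + 1 + 1) ω := fun n ω => by
    rw [hsucc (n + 1)]; ring
  constructor
  · intro n
    change StronglyMeasurable[erwFil η (n + 1)] (erwX η (n + 1))
    refine Measurable.stronglyMeasurable ?_
    refine Finset.measurable_sum (m := erwFil η (n + 1)) _ fun k hk => ?_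
    exact (comap_measurable (η k)).mono
      (le_iSup₂_of_le (f := fun k (_ : k ∈ Finset.Icc 1 (n + 1)) =>
        MeasurableSpace.comap (η k) Real.measurableSpace) k hk le_rfl) le_rfl
  · intro n ω
    rw [hstep]; exact h.pm _ (by omega) ω
  · intro n ω
    refine (Finset.abs_sum_le_sum_abs _ _).trans ?_
    refine (Finset.sum_le_sum (g := fun _ => (1 : ℝ)) fun k hk => ?_).trans (by simp)
    rcases h.pm k (Finset.mem_Icc.1 hk).1 ω with h1 | h1 <;> rw [h1] <;> simp
  · intro n
    have e : erwX η (n + 1 + 1) - erwX η (n + 1) = η (n + 1 + 1) := by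
      ext ω; exact hstep n ω
    change μ[erwX η (n + 1 + 1) - erwX η (n + 1) | erwFil η (n + 1)] =ᵐ[μ] _
    rw [e]
    have := h.cond (n + 1) (by omega)
    push_cast at this
    exact this

end ERWAux

/-- For the ERW with `p ≤ 3/4`, almost surely `limsup Xₙ = +∞` and `liminf Xₙ = -∞`. -/
theorem erw_limsup_top_liminf_bot
    {Ω : Type*} [MeasurableSpace Ω] {μ : Measure Ω} {p r : ℝ} {η : ℕ → Ω → ℝ}
    (h : IsERW μ p r η) (hp : p ≤ 3 / 4) :
    ∀ᵐ ω ∂μ,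
      Filter.limsup (fun n => ((erwX η n ω : ℝ) : EReal)) atTop = ⊤ ∧
      Filter.liminf (fun n => ((erwX η n ω : ℝ) : EReal)) atTop = ⊥ := by
  have := h.prob
  obtain ⟨ℱ, hC⟩ := ERWAux.core_of_erw h
  have h0 := h.p_mem.1
  filter_upwards [hC.main (by linarith) (by linarith),
    hC.neg.main (by linarith) (by linarith)] with ω h1 h2
  exact ⟨ERWAux.limsup_top h1, ERWAux.liminf_bot h2⟩
end

section
/- For the elephant random walk with memory parameter p > 3/4, almost surely X_n = 0 for only finitely many n; that is, the ERW is transient. -/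
open MeasureTheory Filter

open scoped Topology

/-- The one-step profile of the Lyapunov function. -/
noncomputable def erwG (K n x : ℝ) : ℝ := n / (K * n + x ^ 2)

lemma erwG_nonneg {K n : ℝ} (hK : 3 ≤ K) (hn : 1 ≤ n) (x : ℝ) : 0 ≤ erwG K n x := by
  unfold erwG
  positivity

lemma erwG_le_one {K n : ℝ} (hK : 3 ≤ K) (hn : 1 ≤ n) (x : ℝ) : erwG K n x ≤ 1 := by
  unfold erwG
  rw [div_le_one (by positivity)]
  nlinarith [sq_nonneg x]

lemma erwG_step {K a n x : ℝ} (hK : 3 ≤ K) (hb : 3 ≤ (2 * a - 1) * K) (hn : 1 ≤ n) :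
    (erwG K (n + 1) (x + 1) + erwG K (n + 1) (x - 1)) / 2 +
      (erwG K (n + 1) (x + 1) - erwG K (n + 1) (x - 1)) / 2 * (a * x / n)
      ≤ erwG K n x - (1 / 3) * erwG K n x ^ 3 / n := by
  have hn0 : 0 < n := by linarith
  have hK0 : 0 < K := by linarith
  have h1 : 0 < K * (n + 1) + (x + 1) ^ 2 := by positivity
  have h2 : 0 < K * (n + 1) + (x - 1) ^ 2 := by positivity
  have hE : 0 < K * n + x ^ 2 := by positivity
  set E := K * n + x ^ 2 with hEdef
  set D := E + K + 1 with hD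
  have hP : (K * (n + 1) + (x + 1) ^ 2) * (K * (n + 1) + (x - 1) ^ 2) = D ^ 2 - 4 * x ^ 2 := by
    rw [hD, hEdef]; ring
  have hP0 : 0 < D ^ 2 - 4 * x ^ 2 := by rw [← hP]; positivity
  have hb0 : 0 < 2 * a - 1 := by
    by_contra hc
    nlinarith
  -- the main polynomial inequality
  have hL : (erwG K (n + 1) (x + 1) + erwG K (n + 1) (x - 1)) / 2 +
      (erwG K (n + 1) (x + 1) - erwG K (n + 1) (x - 1)) / 2 * (a * x / n)
      = (n + 1) * (D * n - 2 * a * x ^ 2) / (n * (D ^ 2 - 4 * x ^ 2)) := by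
    rw [← hP]
    unfold erwG
    field_simp
    rw [hD, hEdef]
    ring
  have hN : K * n ^ 3 ≤ n ^ 2 * (D ^ 2 - 4 * x ^ 2) - (n + 1) * (D * n - 2 * a * x ^ 2) * E := by
    have hid : n ^ 2 * (D ^ 2 - 4 * x ^ 2) - (n + 1) * (D * n - 2 * a * x ^ 2) * E - K * n ^ 3
        = ((2 * a - 1) * K - 3) * x ^ 2 * n ^ 2 + (2 * a - 1) * x ^ 4 * n
          + ((K + 1) * n ^ 2 + ((2 * a - 1) * K - 1) * x ^ 2 * n + 2 * a * x ^ 4) := by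
      rw [hD, hEdef]; ring
    have t1 : 0 ≤ ((2 * a - 1) * K - 3) := by linarith
    have t2 : 0 ≤ ((2 * a - 1) * K - 1) := by linarith
    have t3 : 0 ≤ a := by linarith
    have : 0 ≤ ((2 * a - 1) * K - 3) * x ^ 2 * n ^ 2 + (2 * a - 1) * x ^ 4 * n
          + ((K + 1) * n ^ 2 + ((2 * a - 1) * K - 1) * x ^ 2 * n + 2 * a * x ^ 4) := by
      positivity
    linarith
  have hDE : D ≤ 3 * E := by
    rw [hD, hEdef]; nlinarith [sq_nonneg x]
  have hD0 : 0 < D := by rw [hD]; linarith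
  have hDD : D ^ 2 - 4 * x ^ 2 ≤ 9 * E ^ 2 := by nlinarith [sq_nonneg x]
  rw [hL]
  have hg : erwG K n x = n / E := rfl
  rw [hg]
  have key : (1 / 3) * (n / E) ^ 3 / n ≤
      n / E - (n + 1) * (D * n - 2 * a * x ^ 2) / (n * (D ^ 2 - 4 * x ^ 2)) := by
    have e1 : n / E - (n + 1) * (D * n - 2 * a * x ^ 2) / (n * (D ^ 2 - 4 * x ^ 2))
        = (n ^ 2 * (D ^ 2 - 4 * x ^ 2) - (n + 1) * (D * n - 2 * a * x ^ 2) * E)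
          / (E * n * (D ^ 2 - 4 * x ^ 2)) := by
      rw [div_sub_div _ _ hE.ne' (by positivity)]
      congr 1 <;> ring
    have e2 : (1 / 3) * (n / E) ^ 3 / n = (3 * n ^ 3) / (E * n * (9 * E ^ 2)) := by
      field_simp; norm_num
    rw [e1, e2]
    apply div_le_div₀ _ _ (by positivity)
    · gcongr
    · refine le_trans (by positivity) hN
    · refine le_trans ?_ hN
      gcongr
  linarith

lemma erw_real_aux {e c : ℕ → ℝ} {l : ℝ} (he : ∀ n, 0 ≤ e n)
    (hd : ∀ n : ℕ, e (n + 1) ≤ e n - c n / (n + 1)) (hc : Tendsto c atTop (𝓝 l)) : l ≤ 0 := by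
  by_contra hl
  push Not at hl
  have hev : ∀ᶠ n in atTop, l / 2 < c n := hc.eventually (lt_mem_nhds (by linarith))
  obtain ⟨N, hN⟩ := eventually_atTop.1 hev
  have hsum : ∀ m, ∑ i ∈ Finset.range m, (l / 2) * (1 / ((i + N : ℕ) + 1 : ℝ)) ≤ e N - e (m + N) := by
    intro m
    induction m with
    | zero => simp
    | succ m ih =>
      rw [Finset.sum_range_succ]
      have h1 := hd (m + N)
      have h2 := hN (m + N) (by omega)
      have h3 : (l / 2) * (1 / ((m + N : ℕ) + 1 : ℝ)) ≤ c (m + N) / ((m + N : ℕ) + 1 : ℝ) := by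
        rw [mul_one_div]
        gcongr
      have h4 : m + 1 + N = m + N + 1 := by omega
      rw [h4]
      linarith
  have hs : Summable (fun i : ℕ => (l / 2) * (1 / ((i + N : ℕ) + 1 : ℝ))) := by
    refine summable_of_sum_range_le (c := e N) (fun i => by positivity) fun m => ?_
    linarith [hsum m, he (m + N)]
  rw [summable_mul_left_iff (by linarith)] at hs
  have hs' : Summable (fun i : ℕ => (1 / ((i : ℝ) + 1))) :=
    (summable_nat_add_iff (f := fun i : ℕ => (1 / ((i : ℝ) + 1))) N).1 hs
  have : Summable (fun i : ℕ => (1 / (i : ℝ))) := by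
    rw [← summable_nat_add_iff 1]
    simpa using hs'
  exact Real.not_summable_one_div_natCast this

lemma erw_super_tendsto {Ω : Type*} {m0 : MeasurableSpace Ω} {μ : Measure Ω}
    [IsProbabilityMeasure μ] (ℱ : Filtration ℕ m0) (Y : ℕ → Ω → ℝ)
    (hY0 : ∀ n ω, 0 ≤ Y n ω) (hY1 : ∀ n ω, Y n ω ≤ 1)
    (hadp : StronglyAdapted ℱ Y)
    (hstep : ∀ n : ℕ, μ[Y (n + 1) | ℱ n] ≤ᵐ[μ]
      fun ω => Y n ω - (1 / 3) * Y n ω ^ 3 / ((n : ℝ) + 1)) :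
    ∀ᵐ ω ∂μ, Tendsto (fun n => Y n ω) atTop (𝓝 0) := by
  have hsm : ∀ n, StronglyMeasurable (Y n) := fun n => (hadp n).mono (ℱ.le n)
  have hnorm : ∀ n ω, ‖Y n ω‖ ≤ 1 := fun n ω => by
    rw [Real.norm_of_nonneg (hY0 n ω)]; exact hY1 n ω
  have hint : ∀ n, Integrable (Y n) μ := fun n =>
    Integrable.of_bound (hsm n).aestronglyMeasurable 1 (ae_of_all _ (hnorm n))
  have hnorm3 : ∀ n ω, ‖Y n ω ^ 3‖ ≤ 1 := fun n ω => by
    rw [norm_pow]; exact pow_le_one₀ (norm_nonneg _) (hnorm n ω)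
  have hint3 : ∀ n, Integrable (fun ω => Y n ω ^ 3) μ := fun n =>
    Integrable.of_bound ((hsm n).pow 3).aestronglyMeasurable 1 (ae_of_all _ (hnorm3 n))
  have hsup : Supermartingale Y ℱ μ := by
    refine supermartingale_nat hadp hint fun n => ?_
    filter_upwards [hstep n] with ω hω
    refine hω.trans ?_
    have : 0 ≤ (1 / 3) * Y n ω ^ 3 / ((n : ℝ) + 1) := by
      have := hY0 n ω
      positivity
    linarith
  have hconv : ∀ᵐ ω ∂μ, ∃ c, Tendsto (fun n => (-Y) n ω) atTop (𝓝 c) := by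
    refine hsup.neg.exists_ae_tendsto_of_bdd (R := 1) fun n => ?_
    refine (eLpNorm_le_of_ae_bound (C := 1) (ae_of_all _ fun ω => ?_)).trans ?_
    · simpa using hnorm n ω
    · simp
  have hconv' : ∀ᵐ ω ∂μ, ∃ c, Tendsto (fun n => Y n ω) atTop (𝓝 c) := by
    filter_upwards [hconv] with ω ⟨c, hc⟩
    exact ⟨-c, by simpa using hc.neg⟩
  obtain ⟨W, hWm, hW⟩ := measurable_limit_of_tendsto_metrizable_ae
    (fun n => (hsm n).aestronglyMeasurable.aemeasurable) hconv'
  have hlim : Tendsto (fun n => ∫ ω, Y n ω ^ 3 ∂μ) atTop (𝓝 (∫ ω, W ω ^ 3 ∂μ)) := by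
    refine tendsto_integral_of_dominated_convergence (fun _ => 1)
      (fun n => (hint3 n).aestronglyMeasurable) (integrable_const _)
      (fun n => ae_of_all _ (hnorm3 n)) ?_
    filter_upwards [hW] with ω hω using hω.pow 3
  have hW0 : ∀ᵐ ω ∂μ, 0 ≤ W ω := by
    filter_upwards [hW] with ω hω
    exact ge_of_tendsto' hω fun n => hY0 n ω
  have hW1 : ∀ᵐ ω ∂μ, W ω ≤ 1 := by
    filter_upwards [hW] with ω hω
    exact le_of_tendsto' hω fun n => hY1 n ω
  have hdec : ∀ n : ℕ, ∫ ω, Y (n + 1) ω ∂μ ≤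
      ∫ ω, Y n ω ∂μ - ((1 / 3) * ∫ ω, Y n ω ^ 3 ∂μ) / ((n : ℝ) + 1) := by
    intro n
    rw [← integral_condExp (ℱ.le n) (f := Y (n + 1))]
    have hi : Integrable (fun ω => (1 / 3) * Y n ω ^ 3 / ((n : ℝ) + 1)) μ :=
      ((hint3 n).const_mul _).div_const _
    refine (integral_mono_ae integrable_condExp ((hint n).sub hi) (hstep n)).trans_eq ?_
    simp only [Pi.sub_apply]
    rw [integral_sub (hint n) hi, integral_div, integral_const_mul]
  have hle := erw_real_aux (fun n => integral_nonneg (hY0 n)) hdec (hlim.const_mul (1 / 3))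
  have hW3 : Integrable (fun ω => W ω ^ 3) μ := by
    refine Integrable.of_bound (hWm.pow_const 3).aestronglyMeasurable 1 ?_
    filter_upwards [hW0, hW1] with ω h0 h1
    rw [norm_pow, Real.norm_of_nonneg h0]
    exact pow_le_one₀ h0 h1
  have hnn : 0 ≤ᵐ[μ] fun ω => W ω ^ 3 := by
    filter_upwards [hW0] with ω h0
    exact pow_nonneg h0 3
  have hz : ∫ ω, W ω ^ 3 ∂μ = 0 := le_antisymm (by linarith) (integral_nonneg_of_ae hnn)
  rw [integral_eq_zero_iff_of_nonneg_ae hnn hW3] at hz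
  filter_upwards [hW, hz] with ω h1 h2
  have : W ω = 0 := by simpa using h2
  rwa [this] at h1

lemma erwFil_mono {Ω : Type*} (η : ℕ → Ω → ℝ) : Monotone (erwFil η) := by
  intro m n hmn
  unfold erwFil
  refine iSup₂_le fun k hk => ?_
  refine le_iSup₂_of_le k ?_ le_rfl
  simp only [Finset.mem_Icc] at hk ⊢
  omega

lemma erwFil_le {Ω : Type*} [m0 : MeasurableSpace Ω] {η : ℕ → Ω → ℝ}
    (hm : ∀ k, Measurable (η k)) (n : ℕ) : erwFil η n ≤ m0 := by
  unfold erwFil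
  exact iSup₂_le fun k _ => (hm k).comap_le

lemma erwX_meas {Ω : Type*} (η : ℕ → Ω → ℝ) (n : ℕ) : Measurable[erwFil η n] (erwX η n) := by
  unfold erwX
  refine Finset.measurable_fun_sum _ fun k hk => ?_
  refine Measurable.mono (comap_measurable (η k)) ?_ le_rfl
  unfold erwFil
  exact le_iSup₂_of_le k hk le_rfl

lemma erwX_succ {Ω : Type*} (η : ℕ → Ω → ℝ) (n : ℕ) (ω : Ω) :
    erwX η (n + 1) ω = erwX η n ω + η (n + 1) ω := by
  unfold erwX
  rw [Finset.sum_Icc_succ_top (by omega)]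

lemma erwG_measurable (K n : ℝ) : Measurable (erwG K n) := by
  unfold erwG
  fun_prop

lemma erw_cond_step {Ω : Type*} [MeasurableSpace Ω] {μ : Measure Ω} {p r : ℝ} {η : ℕ → Ω → ℝ}
    (h : IsERW μ p r η) {K : ℝ} (hK : 3 ≤ K) (hb : 3 ≤ (2 * (2 * p - 1) - 1) * K)
    (n : ℕ) (hn : 1 ≤ n) :
    μ[fun ω => erwG K ((n : ℝ) + 1) (erwX η (n + 1) ω) | erwFil η n] ≤ᵐ[μ]
      fun ω => erwG K n (erwX η n ω) - (1 / 3) * erwG K n (erwX η n ω) ^ 3 / n := by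
  have := h.prob
  have hn1 : (1 : ℝ) ≤ n := by exact_mod_cast hn
  have hn2 : (1 : ℝ) ≤ (n : ℝ) + 1 := by linarith
  have hle := erwFil_le h.meas n
  let P : Ω → ℝ := fun ω => erwG K ((n : ℝ) + 1) (erwX η n ω + 1)
  let Q : Ω → ℝ := fun ω => erwG K ((n : ℝ) + 1) (erwX η n ω - 1)
  have hP : Measurable[erwFil η n] P :=
    (erwG_measurable K _).comp ((erwX_meas η n).add_const 1)
  have hQ : Measurable[erwFil η n] Q :=
    (erwG_measurable K _).comp ((erwX_meas η n).sub_const 1)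
  let A : Ω → ℝ := fun ω => (P ω + Q ω) / 2
  let B : Ω → ℝ := fun ω => (P ω - Q ω) / 2
  have hA : StronglyMeasurable[erwFil η n] A := ((hP.add hQ).div_const 2).stronglyMeasurable
  have hB : StronglyMeasurable[erwFil η n] B := ((hP.sub hQ).div_const 2).stronglyMeasurable
  have bP : ∀ ω, 0 ≤ P ω ∧ P ω ≤ 1 := fun ω => ⟨erwG_nonneg hK hn2 _, erwG_le_one hK hn2 _⟩
  have bQ : ∀ ω, 0 ≤ Q ω ∧ Q ω ≤ 1 := fun ω => ⟨erwG_nonneg hK hn2 _, erwG_le_one hK hn2 _⟩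
  have bA : ∀ ω, ‖A ω‖ ≤ 1 := fun ω => by
    have := bP ω
    have := bQ ω
    rw [Real.norm_eq_abs, abs_le]
    constructor <;> simp only [A] <;> linarith
  have bB : ∀ ω, ‖B ω‖ ≤ 1 := fun ω => by
    have := bP ω
    have := bQ ω
    rw [Real.norm_eq_abs, abs_le]
    constructor <;> simp only [B] <;> linarith
  have hAi : Integrable A μ :=
    Integrable.of_bound (hA.mono hle).aestronglyMeasurable 1 (ae_of_all _ bA)
  have hηb : ∀ ω, ‖η (n + 1) ω‖ ≤ 1 := fun ω => by
    rcases h.pm (n + 1) (by omega) ω with e | e <;> simp [e]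
  have hηi : Integrable (η (n + 1)) μ :=
    Integrable.of_bound (h.meas _).aestronglyMeasurable 1 (ae_of_all _ hηb)
  have hBη : Integrable (B * η (n + 1)) μ :=
    hηi.bdd_mul (c := 1) (hB.mono hle).aestronglyMeasurable (ae_of_all _ bB)
  have hdecomp : (fun ω => erwG K ((n : ℝ) + 1) (erwX η (n + 1) ω)) = A + B * η (n + 1) := by
    funext ω
    simp only [Pi.add_apply, Pi.mul_apply, A, B, P, Q, erwX_succ]
    rcases h.pm (n + 1) (by omega) ω with e | e
    · rw [e]; ring
    · rw [e, ← sub_eq_add_neg]; ring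
  rw [hdecomp]
  filter_upwards [condExp_add hAi hBη (erwFil η n),
    condExp_mul_of_stronglyMeasurable_left hB hBη hηi, h.cond n hn] with ω h1 h2 h3
  rw [h1, Pi.add_apply, h2, Pi.mul_apply, h3, condExp_of_stronglyMeasurable hle hA hAi]
  exact erwG_step hK hb hn1

/-- For the ERW with `p > 3/4`, almost surely `Xₙ = 0` for only finitely many `n`:
the elephant random walk is transient. -/
theorem erw_transient
    {Ω : Type*} [MeasurableSpace Ω] {μ : Measure Ω} {p r : ℝ} {η : ℕ → Ω → ℝ}
    (h : IsERW μ p r η) (hp : 3 / 4 < p) :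
    ∀ᵐ ω ∂μ, {n : ℕ | erwX η n ω = 0}.Finite := by
  have := h.prob
  have hb0 : 0 < 2 * (2 * p - 1) - 1 := by linarith
  have hp1 : p ≤ 1 := h.p_mem.2
  obtain ⟨K, hKdef⟩ : ∃ K : ℝ, K = 3 / (2 * (2 * p - 1) - 1) := ⟨_, rfl⟩
  have hb : (2 * (2 * p - 1) - 1) * K = 3 := by
    rw [hKdef]; field_simp
  have hK : 3 ≤ K := by
    rw [hKdef, le_div_iff₀ hb0]; linarith
  let ℱ : Filtration ℕ ‹MeasurableSpace Ω› :=
    { seq := fun n => erwFil η (n + 1)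
      mono' := fun i j hij => erwFil_mono η (by omega)
      le' := fun i => erwFil_le h.meas (i + 1) }
  have hcast : ∀ n : ℕ, (1 : ℝ) ≤ (n : ℝ) + 1 := fun n => by
    have : (0 : ℝ) ≤ n := Nat.cast_nonneg n
    linarith
  have hT := erw_super_tendsto (μ := μ) ℱ
    (fun n ω => erwG K ((n : ℝ) + 1) (erwX η (n + 1) ω))
    (fun n ω => erwG_nonneg hK (hcast n) _) (fun n ω => erwG_le_one hK (hcast n) _)
    (fun n => ((erwG_measurable K _).comp (erwX_meas η (n + 1))).stronglyMeasurable)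
    (fun n => by
      have := erw_cond_step h hK hb.ge (n + 1) (by omega)
      push_cast at this ⊢
      exact this)
  filter_upwards [hT] with ω hω
  have hK0 : 0 < 1 / K := by positivity
  obtain ⟨N, hN⟩ := eventually_atTop.1 (hω.eventually (gt_mem_nhds hK0))
  refine (Set.finite_lt_nat (N + 1)).subset fun n hn => ?_
  simp only [Set.mem_setOf_eq] at hn ⊢
  by_contra hlt
  obtain ⟨m, rfl⟩ : ∃ m, n = m + 1 := ⟨n - 1, by omega⟩
  have h1 := hN m (by omega)
  rw [hn] at h1
  have h2 : erwG K ((m : ℝ) + 1) 0 = 1 / K := by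
    have := hcast m
    unfold erwG
    field_simp
    simp
  linarith
end
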